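/- arXiv:2001.09850 — 2 statements merged into one kernel-verified Lean document; each statement's English description precedes it below -/
import Mathlib

section
/- For all u, v > 0, the rate function I(u,v) satisfies the identity I(u,v) = 8·F(v/u) + 4·(1+v²)/u − 4π², where F : (0,∞) → ℝ is defined as follows: for 0 < r < 1, F(r) := x₁²/2 − r·cosh x₁ + π²/2, where x₁ > 0 is the unique positive solution of r·sinh(x₁)/x₁ = 1; for r > 1, F(r) := −y₁²/2 + r·cos y₁ + π·y₁, where y₁ ∈ (0,π) is the unique solution of y₁ + r·sin y₁ = π; and F(1) := π²/2 − 1. -/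
open MeasureTheory ProbabilityTheory Filter Real

/-- The variational rate function `I(u,v)`: infimum of `4∫₀¹ f'(z)² dz` over absolutely
continuous `f : [0,1] → ℝ` (written as `f(z) = ∫₀ᶻ g`) with square-integrable derivative `g`,
`f(0) = 0`, `∫₀¹ e^{2 f(z)} dz = u` and `e^{f(1)} = v`. -/
noncomputable def ratefun (u v : ℝ) : ℝ :=
  sInf {r : ℝ | ∃ g : ℝ → ℝ,
    IntervalIntegrable g volume 0 1 ∧
    IntervalIntegrable (fun z => (g z) ^ 2) volume 0 1 ∧
    (∫ z in (0:ℝ)..(1:ℝ), Real.exp (2 * ∫ t in (0:ℝ)..z, g t)) = u ∧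
    Real.exp (∫ t in (0:ℝ)..(1:ℝ), g t) = v ∧
    r = 4 * ∫ z in (0:ℝ)..(1:ℝ), (g z) ^ 2}

/-- The outer composition of an absolutely continuous function with a `C^1` function is absolutely
continuous. -/
theorem AbsolutelyContinuousOnInterval.contDiffOn_comp {f ψ : ℝ → ℝ} {a b : ℝ}
    (hf : AbsolutelyContinuousOnInterval f a b) (hψ : ContDiffOn ℝ 1 ψ (f '' Set.uIcc a b)) :
    AbsolutelyContinuousOnInterval (fun x => ψ (f x)) a b := by
  have hcomp : IsCompact (f '' Set.uIcc a b) := isCompact_uIcc.image_of_continuousOn hf.continuousOn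
  have hconv : Convex ℝ (f '' Set.uIcc a b) := by
    have : Set.OrdConnected (f '' Set.uIcc a b) :=
      (isPreconnected_uIcc.image f hf.continuousOn).ordConnected
    exact this.convex
  obtain ⟨K, hK⟩ := hψ.exists_lipschitzOnWith (by decide) hconv hcomp
  rw [absolutelyContinuousOnInterval_iff] at hf ⊢
  intro ε hε
  obtain ⟨δ, hδ, h⟩ := hf (ε / (K + 1)) (by positivity)
  refine ⟨δ, hδ, fun E hE hlen => ?_⟩
  calc ∑ i ∈ Finset.range E.1, dist (ψ (f (E.2 i).1)) (ψ (f (E.2 i).2))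
      ≤ ∑ i ∈ Finset.range E.1, K * dist (f (E.2 i).1) (f (E.2 i).2) :=
        Finset.sum_le_sum fun i hi => hK.dist_le_mul _ (Set.mem_image_of_mem f (hE.1 i hi).1) _
          (Set.mem_image_of_mem f (hE.1 i hi).2)
    _ = K * ∑ i ∈ Finset.range E.1, dist (f (E.2 i).1) (f (E.2 i).2) := (Finset.mul_sum ..).symm
    _ ≤ K * (ε / (K + 1)) := by gcongr; exact (h E hE hlen).le
    _ < (K + 1) * (ε / (K + 1)) := by gcongr; linarith
    _ = ε := by field

/-- The increment of an absolutely continuous function is at most the integral of any integrable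
upper bound for its derivative. -/
theorem AbsolutelyContinuousOnInterval.sub_le_integral {W W' φ : ℝ → ℝ}
    (hW : AbsolutelyContinuousOnInterval W 0 1)
    (hderiv : ∀ᵐ x, x ∈ Set.uIcc (0 : ℝ) 1 → HasDerivAt W (W' x) x)
    (hle : ∀ x ∈ Set.Icc (0 : ℝ) 1, W' x ≤ φ x) (hφ : IntervalIntegrable φ volume 0 1) :
    W 1 - W 0 ≤ ∫ z in (0 : ℝ)..1, φ z := by
  rw [← hW.integral_deriv_eq_sub]
  refine intervalIntegral.integral_mono_ae_restrict zero_le_one hW.intervalIntegrable_deriv hφ ?_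
  rw [EventuallyLE, ae_restrict_iff' measurableSet_Icc]
  filter_upwards [hderiv] with x hx hmem
  rw [(hx (Set.Icc_subset_uIcc hmem)).deriv]
  exact hle x hmem

/-- The lower bound for the energy given by the planar path with polar coordinates
`(e^{f(z)}, κ z)`. -/
theorem planar_lower_bound {u v : ℝ} (hu : 0 < u) (κ : ℝ) {g : ℝ → ℝ}
    (hg : IntervalIntegrable g volume 0 1)
    (hg2 : IntervalIntegrable (fun z => g z ^ 2) volume 0 1)
    (hgu : (∫ z in (0 : ℝ)..1, exp (2 * ∫ t in (0 : ℝ)..z, g t)) = u)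
    (hgv : exp (∫ t in (0 : ℝ)..1, g t) = v) :
    -κ ^ 2 + (1 + v ^ 2 - 2 * v * cos κ) / u ≤ ∫ z in (0 : ℝ)..1, g z ^ 2 := by
  set f : ℝ → ℝ := fun z => ∫ t in (0 : ℝ)..z, g t with hf
  set p : ℝ := (v * cos κ - 1) / u with hp
  set q : ℝ := v * sin κ / u with hq
  have hf0 : f 0 = 0 := by simp [hf]
  have hfac : AbsolutelyContinuousOnInterval f 0 1 :=
    hg.absolutelyContinuousOnInterval_intervalIntegral (by simp)
  have hexp : AbsolutelyContinuousOnInterval (fun z => exp (f z)) 0 1 :=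
    hfac.contDiffOn_comp contDiff_exp.contDiffOn
  have htrig : AbsolutelyContinuousOnInterval
      (fun z => p * cos (κ * z) + q * sin (κ * z)) 0 1 := by
    apply ContDiffOn.absolutelyContinuousOnInterval
    fun_prop
  have hexpint : IntervalIntegrable (fun z => exp (2 * f z)) volume 0 1 := by
    apply ContinuousOn.intervalIntegrable
    exact (continuousOn_const.mul hfac.continuousOn).rexp
  have key := ((hexp.fun_mul htrig).const_mul 2).sub_le_integral
    (W' := fun z => 2 * (exp (f z) * g z * (p * cos (κ * z) + q * sin (κ * z)) +
      exp (f z) * (κ * (q * cos (κ * z) - p * sin (κ * z)))))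
    (φ := fun z => (g z ^ 2 + κ ^ 2) + (p ^ 2 + q ^ 2) * exp (2 * f z)) ?_ ?_ ?_
  · have hI : ∫ z in (0 : ℝ)..1, ((g z ^ 2 + κ ^ 2) + (p ^ 2 + q ^ 2) * exp (2 * f z)) =
        (∫ z in (0 : ℝ)..1, g z ^ 2) + κ ^ 2 + (p ^ 2 + q ^ 2) * u := by
      rw [intervalIntegral.integral_add (hg2.add (by simp)) (hexpint.const_mul _),
        intervalIntegral.integral_add hg2 (by simp), intervalIntegral.integral_const_mul, hgu]
      simp
    have hgv' : exp (f 1) = v := hgv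
    rw [hI, hgv', hf0] at key
    simp only [mul_one, mul_zero, cos_zero, sin_zero, exp_zero, add_zero, one_mul] at key
    have hid : 2 * (v * (p * cos κ + q * sin κ)) - 2 * p - (p ^ 2 + q ^ 2) * u =
        (1 + v ^ 2 - 2 * v * cos κ) / u := by
      rw [hp, hq]
      field_simp
      linear_combination v ^ 2 * sin_sq_add_cos_sq κ
    linarith
  · filter_upwards [hg.ae_hasDerivAt_integral] with x hx hmem
    have h1 : HasDerivAt f (g x) x := hx hmem 0 (by simp)
    have hk : HasDerivAt (fun z => κ * z) κ x := by simpa using (hasDerivAt_id x).const_mul κ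
    convert! (h1.exp.mul ((hk.cos.const_mul p).add (hk.sin.const_mul q))).const_mul 2 using 1
    simp only [Pi.add_apply]
    ring
  · intro x _
    have h2 : exp (2 * f x) = exp (f x) ^ 2 := by rw [← exp_nat_mul]; norm_num
    have hs := sin_sq_add_cos_sq (κ * x)
    simp only [h2]
    have hid : (g x ^ 2 + κ ^ 2) + (p ^ 2 + q ^ 2) * exp (f x) ^ 2 -
        2 * (exp (f x) * g x * (p * cos (κ * x) + q * sin (κ * x)) +
        exp (f x) * (κ * (q * cos (κ * x) - p * sin (κ * x)))) =
        (g x - exp (f x) * (p * cos (κ * x) + q * sin (κ * x))) ^ 2 +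
        (κ - exp (f x) * (q * cos (κ * x) - p * sin (κ * x))) ^ 2 := by
      linear_combination (-(p ^ 2 + q ^ 2) * exp (f x) ^ 2) * hs
    nlinarith [sq_nonneg (g x - exp (f x) * (p * cos (κ * x) + q * sin (κ * x))),
      sq_nonneg (κ - exp (f x) * (q * cos (κ * x) - p * sin (κ * x)))]
  · exact (hg2.add (by simp)).add (hexpint.const_mul _)

/-- The lower bound for the energy obtained by applying a Möbius transformation to
`z ↦ ∫₀ᶻ e^{2f}`. -/
theorem moebius_lower_bound {u v : ℝ} (hu : 0 < u) (hv : 0 < v) (κ : ℝ) {g : ℝ → ℝ}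
    (hg : IntervalIntegrable g volume 0 1)
    (hg2 : IntervalIntegrable (fun z => g z ^ 2) volume 0 1)
    (hgu : (∫ z in (0 : ℝ)..1, exp (2 * ∫ t in (0 : ℝ)..z, g t)) = u)
    (hgv : exp (∫ t in (0 : ℝ)..1, g t) = v) :
    κ ^ 2 + (1 + v ^ 2 - 2 * v * cosh κ) / u ≤ ∫ z in (0 : ℝ)..1, g z ^ 2 := by
  set f : ℝ → ℝ := fun z => ∫ t in (0 : ℝ)..z, g t with hf
  set a : ℝ → ℝ := fun z => ∫ s in (0 : ℝ)..z, exp (2 * f s) with ha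
  set γ : ℝ := (v * exp (-κ) - 1) / u with hγ
  have hf0 : f 0 = 0 := by simp [hf]
  have ha0 : a 0 = 0 := by simp [ha]
  have ha1 : a 1 = u := hgu
  have hfac : AbsolutelyContinuousOnInterval f 0 1 :=
    hg.absolutelyContinuousOnInterval_intervalIntegral (by simp)
  have hexp : AbsolutelyContinuousOnInterval (fun z => exp (2 * f z)) 0 1 :=
    hfac.contDiffOn_comp (ψ := fun y => exp (2 * y)) (by fun_prop)
  have hexpint : IntervalIntegrable (fun z => exp (2 * f z)) volume 0 1 :=
    hexp.continuousOn.intervalIntegrable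
  have haac : AbsolutelyContinuousOnInterval a 0 1 :=
    hexpint.absolutelyContinuousOnInterval_intervalIntegral (by simp)
  have hD1 : 1 + γ * u = v * exp (-κ) := by rw [hγ]; field_simp; ring
  have hapos : ∀ x ∈ Set.Icc (0 : ℝ) 1, 0 ≤ a x := fun x hx =>
    intervalIntegral.integral_nonneg hx.1 fun _ _ => (exp_pos _).le
  have hale : ∀ x ∈ Set.Icc (0 : ℝ) 1, a x ≤ u := fun x hx => by
    rw [← ha1]
    exact intervalIntegral.integral_mono_interval le_rfl hx.1 hx.2
      (Eventually.of_forall fun _ => (exp_pos _).le) hexpint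
  have hDpos : ∀ x ∈ Set.Icc (0 : ℝ) 1, 0 < 1 + γ * a x := fun x hx => by
    have h1 : 0 < v * exp (-κ) := by positivity
    rcases le_total 0 γ with h | h
    · nlinarith [mul_nonneg h (hapos x hx)]
    · nlinarith [mul_le_mul_of_nonpos_left (hale x hx) h]
  have hsub : ∀ y ∈ a '' Set.uIcc 0 1, 1 + γ * y ≠ 0 := by
    rintro _ ⟨x, hx, rfl⟩
    rw [Set.uIcc_of_le zero_le_one] at hx
    exact (hDpos x hx).ne'
  have hinv : AbsolutelyContinuousOnInterval (fun z => γ / (1 + γ * a z)) 0 1 :=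
    haac.contDiffOn_comp (ψ := fun y => γ / (1 + γ * y))
      (contDiffOn_const.div (by fun_prop) hsub)
  have hlog : AbsolutelyContinuousOnInterval (fun z => log (1 + γ * a z)) 0 1 :=
    haac.contDiffOn_comp (ψ := fun y => log (1 + γ * y)) (ContDiffOn.log (by fun_prop) hsub)
  have key := (((hexp.fun_mul hinv).fun_add (hfac.const_mul (2 * κ))).fun_sub
      (hlog.const_mul (2 * κ))).sub_le_integral
    (W' := fun z => 2 * g z * (γ * exp (2 * f z) / (1 + γ * a z)) -
      (γ * exp (2 * f z) / (1 + γ * a z)) ^ 2 + 2 * κ * g z -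
      2 * κ * (γ * exp (2 * f z) / (1 + γ * a z)))
    (φ := fun z => g z ^ 2 + κ ^ 2) ?_ ?_ ?_
  · have hI : ∫ z in (0 : ℝ)..1, (g z ^ 2 + κ ^ 2) = (∫ z in (0 : ℝ)..1, g z ^ 2) + κ ^ 2 := by
      rw [intervalIntegral.integral_add hg2 (by simp)]
      simp
    have hf1 : f 1 = log v := by rw [← hgv, log_exp]
    have hexp1 : exp (2 * log v) = v ^ 2 := by
      rw [two_mul, exp_add, exp_log hv, sq]
    rw [hI, ha0, ha1, hD1, hf0, hf1, hexp1, log_mul hv.ne' (exp_pos _).ne', log_exp] at key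
    simp only [mul_zero, add_zero, exp_zero, log_one, sub_zero, div_one, one_mul] at key
    have hid : v ^ 2 * (γ / (v * exp (-κ))) - γ = (1 + v ^ 2 - 2 * v * cosh κ) / u := by
      rw [hγ, cosh_eq, exp_neg]
      field_simp
      ring
    linarith
  · filter_upwards [hg.ae_hasDerivAt_integral, hexpint.ae_hasDerivAt_integral] with x hx hx' hmem
    have h1 : HasDerivAt f (g x) x := hx hmem 0 (by simp)
    have h2 : HasDerivAt a (exp (2 * f x)) x := hx' hmem 0 (by simp)
    rw [Set.uIcc_of_le zero_le_one] at hmem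
    have hne := (hDpos x hmem).ne'
    have h3 : HasDerivAt (fun z => 1 + γ * a z) (γ * exp (2 * f x)) x :=
      (h2.const_mul γ).const_add 1
    convert! (((h1.const_mul 2).exp.mul ((hasDerivAt_const x γ).div h3 hne)).add
      (h1.const_mul (2 * κ))).sub ((h3.log hne).const_mul (2 * κ)) using 1
    simp only [Pi.div_apply]
    field_simp
    ring
  · intro x _
    nlinarith [sq_nonneg (g x - γ * exp (2 * f x) / (1 + γ * a x) - κ)]
  · exact hg2.add (by simp)

/-- The energy of the path `f = -log h`, where `h` solves `h'' = c h` with `h(0) = 1` and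
`h(1) = 1 / v`, and `S`, `C` are the solutions of this equation generalizing `sin` and `cos`. -/
theorem exists_path_of_wronskian {c v : ℝ} (hv : 0 < v) {S C : ℝ → ℝ}
    (hS : ∀ z, HasDerivAt S (C z) z) (hC : ∀ z, HasDerivAt C (c * S z) z)
    (hS0 : S 0 = 0) (hC0 : C 0 = 1) (hpos : ∀ z ∈ Set.Ioc (0 : ℝ) 1, 0 < S z)
    (hadd : ∀ z, C z * S (1 - z) + S z * C (1 - z) = S 1) :
    ∃ g : ℝ → ℝ, IntervalIntegrable g volume 0 1 ∧
      IntervalIntegrable (fun z => g z ^ 2) volume 0 1 ∧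
      (∫ z in (0 : ℝ)..1, exp (2 * ∫ t in (0 : ℝ)..z, g t)) = v * S 1 ∧
      exp (∫ t in (0 : ℝ)..1, g t) = v ∧
      ∫ z in (0 : ℝ)..1, g z ^ 2 = c + (1 + v ^ 2 - 2 * v * C 1) / (v * S 1) := by
  have hS1 : 0 < S 1 := hpos 1 (by simp)
  set h : ℝ → ℝ := fun z => (S (1 - z) + S z / v) / S 1 with hh
  set k : ℝ → ℝ := fun z => (-C (1 - z) + C z / v) / S 1 with hk
  have hsub : ∀ z : ℝ, HasDerivAt (fun z => 1 - z) (-1) z := fun z => by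
    simpa using (hasDerivAt_id z).const_sub 1
  have hhd : ∀ z, HasDerivAt h (k z) z := fun z => by
    convert! ((((hS (1 - z)).comp z (hsub z))).add ((hS z).div_const v)).div_const (S 1) using 1
    simp only [hk]
    ring
  have hkd : ∀ z, HasDerivAt k (c * h z) z := fun z => by
    convert! ((((hC (1 - z)).comp z (hsub z)).neg).add ((hC z).div_const v)).div_const (S 1) using 1
    simp only [hh]
    ring
  have hnonneg : ∀ z ∈ Set.Icc (0 : ℝ) 1, 0 ≤ S z := fun z hz => by
    rcases hz.1.eq_or_lt with rfl | h0
    · exact hS0.ge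
    · exact (hpos z ⟨h0, hz.2⟩).le
  have hhpos : ∀ z ∈ Set.Icc (0 : ℝ) 1, 0 < h z := fun z hz => by
    refine div_pos ?_ hS1
    rcases hz.1.eq_or_lt with rfl | h0
    · simpa [hS0] using hS1
    · exact add_pos_of_nonneg_of_pos (hnonneg _ ⟨by linarith [hz.2], by linarith⟩)
        (div_pos (hpos z ⟨h0, hz.2⟩) hv)
  have hh0 : h 0 = 1 := by simp [hh, hS0, hS1.ne']
  have hh1 : h 1 = 1 / v := by simp only [hh, sub_self, hS0]; field_simp; ring
  have hk0 : k 0 = (-C 1 + 1 / v) / S 1 := by simp [hk, hC0]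
  have hk1 : k 1 = (-1 + C 1 / v) / S 1 := by simp [hk, hC0]
  have hhc : Continuous h := continuous_iff_continuousAt.2 fun z => (hhd z).continuousAt
  have hkc : Continuous k := continuous_iff_continuousAt.2 fun z => (hkd z).continuousAt
  have hgc : ContinuousOn (fun z => -(k z / h z)) (Set.Icc 0 1) :=
    (hkc.continuousOn.div hhc.continuousOn fun z hz => (hhpos z hz).ne').neg
  have huIcc : Set.uIcc (0 : ℝ) 1 = Set.Icc 0 1 := Set.uIcc_of_le zero_le_one
  have hlog : ∀ z ∈ Set.Icc (0 : ℝ) 1, ∫ t in (0 : ℝ)..z, -(k t / h t) = -log (h z) :=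
    fun z hz => by
      have hss : Set.uIcc 0 z ⊆ Set.Icc 0 1 := by
        rw [Set.uIcc_of_le hz.1]; exact Set.Icc_subset_Icc_right hz.2
      rw [intervalIntegral.integral_eq_sub_of_hasDerivAt (f := fun z => -log (h z))
        (fun t ht => ((hhd t).log (hhpos t (hss ht)).ne').neg)
        (hgc.mono hss).intervalIntegrable]
      simp [hh0]
  refine ⟨fun z => -(k z / h z), (huIcc ▸ hgc).intervalIntegrable,
    ((huIcc ▸ hgc).pow 2).intervalIntegrable, ?_, ?_, ?_⟩
  · have hcongr : ∫ z in (0 : ℝ)..1, exp (2 * ∫ t in (0 : ℝ)..z, -(k t / h t)) =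
        ∫ z in (0 : ℝ)..1, 1 / h z ^ 2 := by
      refine intervalIntegral.integral_congr fun z hz => ?_
      rw [huIcc] at hz
      simp only [hlog z hz]
      rw [mul_neg, exp_neg, two_mul, exp_add, exp_log (hhpos z hz), one_div, sq]
    have hder : ∀ z ∈ Set.uIcc (0 : ℝ) 1, HasDerivAt (fun z => S z / h z) (1 / h z ^ 2) z := by
      intro z hz
      rw [huIcc] at hz
      have hne := (hhpos z hz).ne'
      convert! (hS z).div (hhd z) hne using 1
      congr 1
      simp only [hh, hk]
      field_simp
      linear_combination (-v) * hadd z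
    rw [hcongr, intervalIntegral.integral_eq_sub_of_hasDerivAt hder, hS0, hh1]
    · field_simp
      simp
    · refine (continuousOn_const.div (hhc.continuousOn.pow 2) fun z hz => ?_).intervalIntegrable
      rw [huIcc] at hz
      exact (pow_pos (hhpos z hz) 2).ne'
  · rw [hlog 1 (by simp), hh1, exp_neg, exp_log (by positivity)]
    simp
  · have hder : ∀ z ∈ Set.uIcc (0 : ℝ) 1,
        HasDerivAt (fun z => c * z - k z / h z) ((-(k z / h z)) ^ 2) z := by
      intro z hz
      rw [huIcc] at hz
      have hne := (hhpos z hz).ne'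
      convert! ((hasDerivAt_id z).const_mul c).sub ((hkd z).div (hhd z) hne) using 1
      field_simp
      ring
    rw [intervalIntegral.integral_eq_sub_of_hasDerivAt hder
      ((huIcc ▸ hgc).pow 2).intervalIntegrable, hh0, hh1, hk0, hk1]
    field_simp
    ring

/-- The rate function is determined by a lower bound for the energy which is attained. -/
theorem ratefun_eq_of_isLeast {u v E : ℝ}
    (hle : ∀ g : ℝ → ℝ, IntervalIntegrable g volume 0 1 →
      IntervalIntegrable (fun z => g z ^ 2) volume 0 1 →
      (∫ z in (0 : ℝ)..1, exp (2 * ∫ t in (0 : ℝ)..z, g t)) = u →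
      exp (∫ t in (0 : ℝ)..1, g t) = v → E ≤ ∫ z in (0 : ℝ)..1, g z ^ 2)
    (hex : ∃ g : ℝ → ℝ, IntervalIntegrable g volume 0 1 ∧
      IntervalIntegrable (fun z => g z ^ 2) volume 0 1 ∧
      (∫ z in (0 : ℝ)..1, exp (2 * ∫ t in (0 : ℝ)..z, g t)) = u ∧
      exp (∫ t in (0 : ℝ)..1, g t) = v ∧ ∫ z in (0 : ℝ)..1, g z ^ 2 = E) :
    ratefun u v = 4 * E := by
  refine IsLeast.csInf_eq ⟨?_, ?_⟩
  · obtain ⟨g, h1, h2, h3, h4, h5⟩ := hex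
    exact ⟨g, h1, h2, h3, h4, by rw [h5]⟩
  · rintro _ ⟨g, h1, h2, h3, h4, rfl⟩
    linarith [hle g h1 h2 h3 h4]

/-- The value of the rate function for `v < u`. -/
theorem ratefun_of_sinh {u v κ : ℝ} (hu : 0 < u) (hv : 0 < v) (hκ : 0 < κ)
    (h : v / u * sinh κ = κ) :
    ratefun u v = 4 * (κ ^ 2 + (1 + v ^ 2 - 2 * v * cosh κ) / u) := by
  have hu' : v * (sinh κ / κ) = u := by
    field_simp at h ⊢; linarith
  have hk : ∀ z : ℝ, HasDerivAt (fun z => κ * z) κ z := fun z => by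
    simpa using (hasDerivAt_id z).const_mul κ
  refine ratefun_eq_of_isLeast (fun g h1 h2 h3 h4 => moebius_lower_bound hu hv κ h1 h2 h3 h4) ?_
  have := exists_path_of_wronskian (c := κ ^ 2) hv (S := fun z => sinh (κ * z) / κ)
    (C := fun z => cosh (κ * z))
    (fun z => by convert! (hk z).sinh.div_const κ using 1; field_simp)
    (fun z => by convert! (hk z).cosh using 1; field_simp)
    (by simp) (by simp)
    (fun z hz => div_pos (sinh_pos_iff.2 (mul_pos hκ hz.1)) hκ)
    (fun z => by
      rw [show κ * 1 = κ * z + κ * (1 - z) by ring, sinh_add]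
      ring)
  simpa only [mul_one, hu'] using this

/-- The value of the rate function for `u < v`. -/
theorem ratefun_of_sin {u v κ : ℝ} (hu : 0 < u) (hv : 0 < v) (hκ : κ ∈ Set.Ioo 0 π)
    (h : v / u * sin κ = κ) :
    ratefun u v = 4 * (-κ ^ 2 + (1 + v ^ 2 - 2 * v * cos κ) / u) := by
  have hκ0 := hκ.1
  have hu' : v * (sin κ / κ) = u := by
    field_simp at h ⊢; linarith
  have hk : ∀ z : ℝ, HasDerivAt (fun z => κ * z) κ z := fun z => by
    simpa using (hasDerivAt_id z).const_mul κ
  refine ratefun_eq_of_isLeast (fun g h1 h2 h3 h4 => planar_lower_bound hu κ h1 h2 h3 h4) ?_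
  have := exists_path_of_wronskian (c := -κ ^ 2) hv (S := fun z => sin (κ * z) / κ)
    (C := fun z => cos (κ * z))
    (fun z => by convert! (hk z).sin.div_const κ using 1; field_simp)
    (fun z => by convert! (hk z).cos using 1; field_simp)
    (by simp) (by simp)
    (fun z hz => div_pos (sin_pos_of_pos_of_lt_pi (mul_pos hκ0 hz.1)
      (by nlinarith [hκ.2, hz.2])) hκ0)
    (fun z => by
      rw [show κ * 1 = κ * z + κ * (1 - z) by ring, sin_add]
      ring)
  simpa only [mul_one, hu'] using this

/-- The value of the rate function for `u = v`. -/
theorem ratefun_self {u : ℝ} (hu : 0 < u) :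
    ratefun u u = 4 * ((1 + u ^ 2 - 2 * u) / u) := by
  refine ratefun_eq_of_isLeast (fun g h1 h2 h3 h4 => ?_) ?_
  · simpa using planar_lower_bound hu 0 h1 h2 h3 h4
  · simpa using exists_path_of_wronskian (c := 0) hu (S := fun z => z) (C := fun _ => 1)
      (fun z => hasDerivAt_id z) (fun z => by simpa using hasDerivAt_const z (1 : ℝ))
      rfl rfl (fun z hz => hz.1) (fun z => by ring)

theorem exists_mul_sinh_eq_self {r : ℝ} (h0 : 0 < r) (h1 : r < 1) :
    ∃ x, 0 < x ∧ r * sinh x = x := by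
  have hcont : Continuous fun x => r * sinh x - x := by fun_prop
  have hle : (1 - r) / 2 ≤ 4 / r := by
    rw [le_div_iff₀ h0]
    nlinarith
  have hlo : r * sinh ((1 - r) / 2) - (1 - r) / 2 ≤ 0 := by
    have hx : 0 < 1 - (1 - r) / 2 := by linarith
    have hexp : exp ((1 - r) / 2) ≤ 1 / (1 - (1 - r) / 2) := by
      rw [le_div_iff₀ hx]
      calc exp ((1 - r) / 2) * (1 - (1 - r) / 2)
          ≤ exp ((1 - r) / 2) * exp (-((1 - r) / 2)) := by gcongr; exact one_sub_le_exp_neg _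
        _ = 1 := by rw [← exp_add]; simp
    have hsinh : sinh ((1 - r) / 2) ≤ (1 / (1 - (1 - r) / 2) - (1 - (1 - r) / 2)) / 2 := by
      rw [sinh_eq]
      linarith [one_sub_le_exp_neg ((1 - r) / 2)]
    have hbound : r * ((1 / (1 - (1 - r) / 2) - (1 - (1 - r) / 2)) / 2) ≤ (1 - r) / 2 := by
      have : 0 < 1 + r := by linarith
      rw [show 1 - (1 - r) / 2 = (1 + r) / 2 by ring]
      field_simp
      nlinarith [mul_pos (sub_pos.2 h1) h0, mul_pos (sub_pos.2 h1) this]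
    linarith [mul_le_mul_of_nonneg_left hsinh h0.le]
  have hhi : 0 ≤ r * sinh (4 / r) - 4 / r := by
    have hq := quadratic_le_exp_of_nonneg (x := 4 / r) (by positivity)
    have hneg : exp (-(4 / r)) ≤ 1 := exp_le_one_iff.2 (by simp; positivity)
    have hsinh : (4 / r + (4 / r) ^ 2 / 2) / 2 ≤ sinh (4 / r) := by
      rw [sinh_eq]
      linarith
    have hid : r * ((4 / r + (4 / r) ^ 2 / 2) / 2) = 2 + 4 / r := by field_simp; ring
    linarith [mul_le_mul_of_nonneg_left hsinh h0.le]
  obtain ⟨x, hx, hx0⟩ := intermediate_value_Icc hle hcont.continuousOn ⟨hlo, hhi⟩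
  exact ⟨x, by linarith [hx.1], sub_eq_zero.1 hx0⟩

theorem exists_mul_sin_eq_self {r : ℝ} (h1 : 1 < r) :
    ∃ x ∈ Set.Ioo 0 π, r * sin x = x := by
  have hr : 0 < r := by linarith
  have hcont : Continuous fun x => r * sin x - x := by fun_prop
  have hx0 : 0 < 1 - 1 / r := by rw [sub_pos, div_lt_one hr]; exact h1
  have hx1 : 1 - 1 / r ≤ 1 := sub_le_self _ (by positivity)
  have hlo : 0 ≤ r * sin (1 - 1 / r) - (1 - 1 / r) := by
    have hsin := sin_gt_sub_cube hx0
    have hrx : r * (1 - 1 / r) = r - 1 := by field_simp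
    set x := 1 - 1 / r
    have hsq : x ^ 3 ≤ x ^ 2 := pow_le_pow_of_le_one hx0.le hx1 (by norm_num)
    nlinarith [mul_lt_mul_of_pos_left hsin hr, mul_le_mul_of_nonneg_left hsq hr.le]
  have hpi := pi_gt_three
  obtain ⟨x, hx, hx2⟩ := intermediate_value_Icc' (hx1.trans (by linarith)) hcont.continuousOn
    (show (0 : ℝ) ∈ Set.Icc (r * sin π - π) _ from ⟨by simp; linarith, hlo⟩)
  have hxr : r * sin x = x := sub_eq_zero.1 hx2
  have hxpos : 0 < x := by linarith [hx.1]
  refine ⟨x, ⟨hxpos, lt_of_le_of_ne hx.2 ?_⟩, hxr⟩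
  rintro rfl
  simp only [sin_pi, mul_zero] at hxr
  linarith

/-- The identity `I(u,v) = 8 F(v/u) + 4(1+v²)/u − 4π²`, where `F` is the function appearing in
the small-time expansion of the Hartman–Watson distribution, characterized piecewise via the
unique solutions `x₁` (for `0 < r < 1`) and `y₁` (for `r > 1`) of the indicated equations. -/
theorem ratefun_eq_hartmanWatson (u v : ℝ) (hu : 0 < u) (hv : 0 < v)
    (F : ℝ → ℝ)
    (hF_lt : ∀ r : ℝ, 0 < r → r < 1 → ∀ x₁ : ℝ, 0 < x₁ → r * Real.sinh x₁ / x₁ = 1 →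
      F r = x₁ ^ 2 / 2 - r * Real.cosh x₁ + Real.pi ^ 2 / 2)
    (hF_gt : ∀ r : ℝ, 1 < r → ∀ y₁ : ℝ, y₁ ∈ Set.Ioo 0 Real.pi → y₁ + r * Real.sin y₁ = Real.pi →
      F r = -y₁ ^ 2 / 2 + r * Real.cos y₁ + Real.pi * y₁)
    (hF_one : F 1 = Real.pi ^ 2 / 2 - 1) :
    ratefun u v = 8 * F (v / u) + 4 * (1 + v ^ 2) / u - 4 * Real.pi ^ 2 := by
  rcases lt_trichotomy (v / u) 1 with hr | hr | hr
  · have hr0 : 0 < v / u := div_pos hv hu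
    obtain ⟨x, hx, hxr⟩ := exists_mul_sinh_eq_self hr0 hr
    rw [ratefun_of_sinh hu hv hx hxr,
      hF_lt _ hr0 hr x hx (by rw [hxr, div_self hx.ne'])]
    field_simp
    ring
  · rw [hr, hF_one]
    obtain rfl : v = u := by field_simp at hr; exact hr
    rw [ratefun_self hv]
    field_simp
    ring
  · obtain ⟨x, hx, hxr⟩ := exists_mul_sin_eq_self hr
    rw [ratefun_of_sin hu hv hx hxr,
      hF_gt _ hr (π - x) ⟨by linarith [hx.2], by linarith [hx.1]⟩
        (by rw [sin_pi_sub, hxr]; ring), cos_pi_sub]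
    field_simp
    ring
end

section
/- For every ζ ∈ ℝ, the zero-correlation short-maturity rate function satisfies inf_{u>0, v>0} { (1/2)·I(u,v) + (2/u)·ζ² } = 2·log²(√(ζ² + 1) + |ζ|). -/
open MeasureTheory ProbabilityTheory Filter Real

/-- Postcomposition with a `C¹` function preserves absolute continuity on an interval. -/
theorem absolutelyContinuousOnInterval_comp_of_contDiff {φ f : ℝ → ℝ} {a b : ℝ}
    (hφ : ContDiff ℝ 1 φ) (hf : AbsolutelyContinuousOnInterval f a b) :
    AbsolutelyContinuousOnInterval (fun x => φ (f x)) a b := by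
  obtain ⟨C, hC⟩ := hf.exists_bound
  obtain ⟨K, hK⟩ := hφ.contDiffOn.exists_lipschitzOnWith one_ne_zero
    (convex_Icc (-C) C) isCompact_Icc
  have hmem : ∀ x ∈ Set.uIcc a b, f x ∈ Set.Icc (-C) C := fun x hx => abs_le.mp (hC x hx)
  rw [absolutelyContinuousOnInterval_iff] at hf ⊢
  intro ε hε
  obtain ⟨δ, hδ, h⟩ := hf (ε / (K + 1)) (by positivity)
  refine ⟨δ, hδ, fun E hE hlt => ?_⟩
  have hsum := h E hE hlt
  calc ∑ i ∈ Finset.range E.1, dist (φ (f (E.2 i).1)) (φ (f (E.2 i).2))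
      ≤ ∑ i ∈ Finset.range E.1, (K : ℝ) * dist (f (E.2 i).1) (f (E.2 i).2) := by
        refine Finset.sum_le_sum fun i hi => ?_
        have hi' := hE.1 i hi
        exact hK.dist_le_mul _ (hmem _ hi'.1) _ (hmem _ hi'.2)
    _ = K * ∑ i ∈ Finset.range E.1, dist (f (E.2 i).1) (f (E.2 i).2) := by
        rw [Finset.mul_sum]
    _ ≤ (K + 1) * ∑ i ∈ Finset.range E.1, dist (f (E.2 i).1) (f (E.2 i).2) := by
        gcongr
        simp
    _ < (K + 1) * (ε / (K + 1)) := by gcongr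
    _ = ε := by field_simp

/-- The derivative of `arsinh ((ζ - x) / y)` along a curve is bounded by its hyperbolic speed. -/
theorem sq_arsinh_deriv_le (w p q : ℝ) :
    ((√(1 + w ^ 2))⁻¹ * (-p - w * q)) ^ 2 ≤ q ^ 2 + p ^ 2 := by
  have h : 0 < 1 + w ^ 2 := by positivity
  rw [mul_pow, inv_pow, sq_sqrt h.le, inv_mul_le_iff₀ h]
  nlinarith [sq_nonneg (q - w * p)]

theorem integral_exp_primitive_pos {g : ℝ → ℝ} (hg : IntervalIntegrable g volume 0 1) :
    0 < ∫ z in (0:ℝ)..1, exp (2 * ∫ t in (0:ℝ)..z, g t) := by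
  have hf := hg.absolutelyContinuousOnInterval_intervalIntegral (c := 0) (by simp)
  refine intervalIntegral.intervalIntegral_pos_of_pos ?_ (fun _ => exp_pos _) one_pos
  exact (continuous_exp.comp_continuousOn (hf.continuousOn.const_mul 2)).intervalIntegrable

/-- The variational lower bound: the hyperbolic energy of a curve in the upper half-plane from
`(0, 1)` to the geodesic `x = ζ` is at least the squared distance `arsinh ζ ^ 2`. -/
theorem sq_arsinh_le_energy {g : ℝ → ℝ} (hg : IntervalIntegrable g volume 0 1)
    (hg2 : IntervalIntegrable (fun z => g z ^ 2) volume 0 1) (ζ : ℝ) :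
    arsinh ζ ^ 2 ≤ (∫ z in (0:ℝ)..1, g z ^ 2) +
      ζ ^ 2 / ∫ z in (0:ℝ)..1, exp (2 * ∫ t in (0:ℝ)..z, g t) := by
  have hu := integral_exp_primitive_pos hg
  set u := ∫ z in (0:ℝ)..1, exp (2 * ∫ t in (0:ℝ)..z, g t) with hu_def
  set f : ℝ → ℝ := fun z => ∫ t in (0:ℝ)..z, g t with hf_def
  have hf : AbsolutelyContinuousOnInterval f 0 1 :=
    hg.absolutelyContinuousOnInterval_intervalIntegral (by simp)
  have hE : IntervalIntegrable (fun z => exp (2 * f z)) volume 0 1 :=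
    (continuous_exp.comp_continuousOn (hf.continuousOn.const_mul 2)).intervalIntegrable
  set U : ℝ → ℝ := fun z => ∫ s in (0:ℝ)..z, exp (2 * f s) with hU_def
  have hU : AbsolutelyContinuousOnInterval U 0 1 :=
    hE.absolutelyContinuousOnInterval_intervalIntegral (by simp)
  set W : ℝ → ℝ := fun z => (ζ - ζ / u * U z) * exp (-f z) with hW_def
  have hW : AbsolutelyContinuousOnInterval W 0 1 := by
    have h1 : AbsolutelyContinuousOnInterval (fun z => ζ - ζ / u * U z) 0 1 :=
      absolutelyContinuousOnInterval_comp_of_contDiff (φ := fun x => ζ - ζ / u * x)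
        (by fun_prop) hU
    have h2 : AbsolutelyContinuousOnInterval (fun z => exp (-f z)) 0 1 :=
      absolutelyContinuousOnInterval_comp_of_contDiff (φ := fun x => exp (-x)) (by fun_prop) hf
    exact h1.mul h2
  have hF : AbsolutelyContinuousOnInterval (fun z => arsinh (W z)) 0 1 :=
    absolutelyContinuousOnInterval_comp_of_contDiff contDiff_arsinh hW
  have hF0 : arsinh (W 0) = arsinh ζ := by simp [hW_def, hU_def, hf_def]
  have hF1 : arsinh (W 1) = 0 := by
    have : U 1 = u := rfl
    simp [hW_def, this, hu.ne']
  have hFTC := hF.integral_deriv_eq_sub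
  rw [hF0, hF1, zero_sub] at hFTC
  have hle : ∀ᵐ z, z ∈ Set.Icc (0:ℝ) 1 →
      2 * (-arsinh ζ) * deriv (fun z => arsinh (W z)) z - arsinh ζ ^ 2 ≤
        g z ^ 2 + (ζ / u) ^ 2 * exp (2 * f z) := by
    filter_upwards [hg.ae_hasDerivAt_integral, hE.ae_hasDerivAt_integral] with z hz1 hz2 hz
    rw [← Set.uIcc_of_le zero_le_one] at hz
    have df : HasDerivAt f (g z) z := hz1 hz 0 (by simp)
    have dU : HasDerivAt U (exp (2 * f z)) z := hz2 hz 0 (by simp)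
    have dW : HasDerivAt W (-(ζ / u * exp (f z)) - W z * g z) z := by
      refine (((dU.const_mul (ζ / u)).const_sub ζ).mul df.neg.exp).congr_deriv ?_
      have : exp (2 * f z) * exp (-f z) = exp (f z) := by rw [← exp_add]; ring_nf
      simp only [hW_def]
      linear_combination (-(ζ / u)) * this
    rw [dW.arsinh.deriv]
    have key := sq_arsinh_deriv_le (W z) (ζ / u * exp (f z)) (g z)
    have he : exp (2 * f z) = exp (f z) ^ 2 := by rw [← exp_nat_mul]; norm_num
    rw [smul_eq_mul, he]
    nlinarith [sq_nonneg ((√(1 + W z ^ 2))⁻¹ * (-(ζ / u * exp (f z)) - W z * g z) + arsinh ζ)]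
  have hint := intervalIntegral.integral_mono_ae_restrict zero_le_one
    ((hF.intervalIntegrable_deriv.const_mul (2 * (-arsinh ζ))).sub
      (intervalIntegrable_const (c := arsinh ζ ^ 2)))
    (hg2.add (hE.const_mul ((ζ / u) ^ 2)))
    ((ae_restrict_iff' measurableSet_Icc).mpr hle)
  rw [intervalIntegral.integral_sub (hF.intervalIntegrable_deriv.const_mul _)
      intervalIntegrable_const, intervalIntegral.integral_add hg2 (hE.const_mul _),
    intervalIntegral.integral_const_mul, intervalIntegral.integral_const_mul, hFTC,
    intervalIntegral.integral_const, ← hu_def] at hint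
  have hfin : (ζ / u) ^ 2 * u = ζ ^ 2 / u := by field_simp
  rw [hfin] at hint
  simp only [smul_eq_mul] at hint
  linarith

/-- Every pair of positive constraints is attained by some admissible path. -/
theorem exists_admissible_path {u v : ℝ} (hu : 0 < u) (hv : 0 < v) :
    ∃ g : ℝ → ℝ, Continuous g ∧
      (∫ z in (0:ℝ)..1, exp (2 * ∫ t in (0:ℝ)..z, g t)) = u ∧
      exp (∫ t in (0:ℝ)..1, g t) = v := by
  set h : ℝ → ℝ := fun c => ∫ z in (0:ℝ)..1, exp (2 * (z * log v + c * (z * (1 - z)))) with h_def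
  have hcont : Continuous h :=
    intervalIntegral.continuous_parametric_intervalIntegral_of_continuous' (by fun_prop) 0 1
  have htop : ∃ c, u ≤ h c := by
    refine ⟨3 * (u - 1 - log v), ?_⟩
    set c := 3 * (u - 1 - log v) with hc
    have hlin : ∫ z in (0:ℝ)..1, (2 * (z * log v + c * (z * (1 - z))) + 1) = u := by
      have hd : ∀ z ∈ Set.uIcc (0:ℝ) 1, HasDerivAt
          (fun z : ℝ => z ^ 2 * log v + c * (z ^ 2 - 2 / 3 * z ^ 3) + z)
          (2 * (z * log v + c * (z * (1 - z))) + 1) z := by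
        intro z _
        refine ((((hasDerivAt_pow 2 z).mul_const (log v)).add
          (((hasDerivAt_pow 2 z).sub ((hasDerivAt_pow 3 z).const_mul (2 / 3))).const_mul c)).add
          (hasDerivAt_id z)).congr_deriv ?_
        norm_num
        ring
      rw [intervalIntegral.integral_eq_sub_of_hasDerivAt hd
        (by apply Continuous.intervalIntegrable; fun_prop)]
      rw [hc]
      ring
    rw [← hlin]
    refine intervalIntegral.integral_mono_on zero_le_one
      (by apply Continuous.intervalIntegrable; fun_prop)
      (by apply Continuous.intervalIntegrable; fun_prop) fun z _ => add_one_le_exp _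
  have hbot : ∃ c, h c ≤ u := by
    have hlim : Tendsto h atBot (nhds (∫ _ in (0:ℝ)..1, (0:ℝ))) := by
      refine intervalIntegral.tendsto_integral_filter_of_dominated_convergence
        (fun _ => exp (2 * |log v|)) (Eventually.of_forall fun c => ?_) ?_
        intervalIntegrable_const ?_
      · exact Continuous.aestronglyMeasurable (by fun_prop)
      · filter_upwards [eventually_le_atBot 0] with c hc
        refine Eventually.of_forall fun z hz => ?_
        rw [Set.uIoc_of_le zero_le_one] at hz
        rw [norm_of_nonneg (exp_pos _).le, exp_le_exp]
        have h1 : z * log v ≤ |log v| :=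
          (mul_le_mul_of_nonneg_left (le_abs_self _) hz.1.le).trans
            (mul_le_of_le_one_left (abs_nonneg _) hz.2)
        have h2 : c * (z * (1 - z)) ≤ 0 :=
          mul_nonpos_of_nonpos_of_nonneg hc (mul_nonneg hz.1.le (by linarith [hz.2]))
        linarith
      · filter_upwards [Measure.ae_ne volume (1:ℝ)] with z hz1 hz
        rw [Set.uIoc_of_le zero_le_one] at hz
        have hpos : 0 < z * (1 - z) :=
          mul_pos hz.1 (sub_pos.mpr (lt_of_le_of_ne hz.2 hz1))
        refine tendsto_exp_atBot.comp (Tendsto.const_mul_atBot two_pos ?_)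
        exact tendsto_atBot_add_const_left _ _ (tendsto_id.atBot_mul_const hpos)
    rw [intervalIntegral.integral_zero] at hlim
    exact (hlim.eventually_le_const hu).exists
  obtain ⟨c₁, hc₁⟩ := htop
  obtain ⟨c₀, hc₀⟩ := hbot
  obtain ⟨c, hc⟩ := mem_range_of_exists_le_of_exists_ge hcont ⟨c₀, hc₀⟩ ⟨c₁, hc₁⟩
  have hprim : ∀ z : ℝ, ∫ t in (0:ℝ)..z, (log v + c * (1 - 2 * t)) =
      z * log v + c * (z * (1 - z)) := by
    intro z
    have hd : ∀ t ∈ Set.uIcc (0:ℝ) z, HasDerivAt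
        (fun t : ℝ => t * log v + c * (t - t ^ 2)) (log v + c * (1 - 2 * t)) t := by
      intro t _
      refine (((hasDerivAt_id t).mul_const (log v)).add
        (((hasDerivAt_id t).sub (hasDerivAt_pow 2 t)).const_mul c)).congr_deriv ?_
      norm_num
    rw [intervalIntegral.integral_eq_sub_of_hasDerivAt hd
      (by apply Continuous.intervalIntegrable; fun_prop)]
    ring
  refine ⟨fun t => log v + c * (1 - 2 * t), by fun_prop, ?_, ?_⟩
  · simp only [hprim]
    exact hc
  · rw [hprim]
    simp [exp_log hv]

theorem ratefun_le {g : ℝ → ℝ} (hg : IntervalIntegrable g volume 0 1)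
    (hg2 : IntervalIntegrable (fun z => g z ^ 2) volume 0 1) :
    ratefun (∫ z in (0:ℝ)..1, exp (2 * ∫ t in (0:ℝ)..z, g t)) (exp (∫ t in (0:ℝ)..1, g t)) ≤
      4 * ∫ z in (0:ℝ)..1, g z ^ 2 := by
  refine csInf_le ⟨0, ?_⟩ ⟨g, hg, hg2, rfl, rfl, rfl⟩
  rintro r ⟨g, -, -, -, -, rfl⟩
  have : 0 ≤ ∫ z in (0:ℝ)..1, g z ^ 2 :=
    intervalIntegral.integral_nonneg zero_le_one fun _ _ => sq_nonneg _
  positivity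

theorem two_mul_sq_arsinh_le {u v : ℝ} (hu : 0 < u) (hv : 0 < v) (ζ : ℝ) :
    2 * arsinh ζ ^ 2 ≤ 1 / 2 * ratefun u v + 2 / u * ζ ^ 2 := by
  have h : 4 * (arsinh ζ ^ 2 - ζ ^ 2 / u) ≤ ratefun u v := by
    refine le_csInf ?_ ?_
    · obtain ⟨g, hg, h1, h2⟩ := exists_admissible_path hu hv
      exact ⟨_, g, hg.intervalIntegrable 0 1, (hg.pow 2).intervalIntegrable 0 1, h1, h2, rfl⟩
    · rintro r ⟨g, hg, hg2, rfl, -, rfl⟩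
      linarith [sq_arsinh_le_energy hg hg2 ζ]
  have : 2 / u * ζ ^ 2 = 2 * (ζ ^ 2 / u) := by ring
  linarith

theorem hasDerivAt_tanh_mul_one_sub (a z : ℝ) :
    HasDerivAt (fun z => tanh (a * (1 - z))) (-a / cosh (a * (1 - z)) ^ 2) z := by
  have hin : HasDerivAt (fun z => a * (1 - z)) (-a) z :=
    (((hasDerivAt_id z).const_sub 1).const_mul a).congr_deriv (by ring)
  simp only [tanh_eq_sinh_div_cosh]
  refine (hin.sinh.div hin.cosh (cosh_pos _).ne').congr_deriv ?_
  congr 1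
  linear_combination (-a) * cosh_sq (a * (1 - z))

theorem continuous_tanh_mul_one_sub (a : ℝ) : Continuous fun z => tanh (a * (1 - z)) :=
  continuous_iff_continuousAt.mpr fun z => (hasDerivAt_tanh_mul_one_sub a z).continuousAt

theorem integral_tanh_mul_one_sub (a z : ℝ) :
    ∫ t in (0:ℝ)..z, a * tanh (a * (1 - t)) = log (cosh a) - log (cosh (a * (1 - z))) := by
  have hd : ∀ t ∈ Set.uIcc 0 z, HasDerivAt (fun t => -log (cosh (a * (1 - t))))
      (a * tanh (a * (1 - t))) t := by
    intro t _
    have hin : HasDerivAt (fun z => a * (1 - z)) (-a) t :=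
      (((hasDerivAt_id t).const_sub 1).const_mul a).congr_deriv (by ring)
    refine (hin.cosh.log (cosh_pos _).ne').neg.congr_deriv ?_
    rw [tanh_eq_sinh_div_cosh]
    ring
  rw [intervalIntegral.integral_eq_sub_of_hasDerivAt hd
    (((continuous_tanh_mul_one_sub a).const_mul a).intervalIntegrable 0 z)]
  simp only [sub_zero, mul_one]
  ring

theorem integral_inv_cosh_sq {a : ℝ} (ha : a ≠ 0) :
    ∫ z in (0:ℝ)..1, (cosh (a * (1 - z)) ^ 2)⁻¹ = tanh a / a := by
  have hd : ∀ z ∈ Set.uIcc (0:ℝ) 1, HasDerivAt (fun z => -(tanh (a * (1 - z)) / a))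
      (cosh (a * (1 - z)) ^ 2)⁻¹ z := by
    intro z _
    refine ((hasDerivAt_tanh_mul_one_sub a z).div_const a).neg.congr_deriv ?_
    have := (cosh_pos (a * (1 - z))).ne'
    field_simp
  rw [intervalIntegral.integral_eq_sub_of_hasDerivAt hd]
  · simp
  · refine Continuous.intervalIntegrable (Continuous.inv₀ ?_ fun z => ?_) 0 1
    · exact (continuous_cosh.comp (by fun_prop)).pow 2
    · exact pow_ne_zero 2 (cosh_pos _).ne'

/-- The hyperbolic geodesic from `(0, 1)` orthogonal to the line `x = ζ` attains the bound. -/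
theorem exists_optimal_path (ζ : ℝ) :
    ∃ g : ℝ → ℝ, Continuous g ∧ (∫ z in (0:ℝ)..1, g z ^ 2) +
      ζ ^ 2 / (∫ z in (0:ℝ)..1, exp (2 * ∫ t in (0:ℝ)..z, g t)) = arsinh ζ ^ 2 := by
  rcases eq_or_ne ζ 0 with rfl | hζ
  · exact ⟨fun _ => 0, continuous_const, by simp⟩
  set a := arsinh ζ with ha_def
  have ha : a ≠ 0 := by simpa [ha_def] using hζ
  have hs : sinh a = ζ := sinh_arsinh ζ
  have hc := (cosh_pos a).ne'
  refine ⟨fun t => a * tanh (a * (1 - t)), (continuous_tanh_mul_one_sub a).const_mul a, ?_⟩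
  have hexp : ∀ z : ℝ, exp (2 * ∫ t in (0:ℝ)..z, a * tanh (a * (1 - t))) =
      cosh a ^ 2 * (cosh (a * (1 - z)) ^ 2)⁻¹ := by
    intro z
    rw [integral_tanh_mul_one_sub, ← log_div hc (cosh_pos _).ne', two_mul, exp_add,
      exp_log (div_pos (cosh_pos _) (cosh_pos _))]
    ring
  have hsq : ∀ z : ℝ, (a * tanh (a * (1 - z))) ^ 2 =
      a ^ 2 - a ^ 2 * (cosh (a * (1 - z)) ^ 2)⁻¹ := by
    intro z
    have := (cosh_pos (a * (1 - z))).ne'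
    rw [tanh_eq_sinh_div_cosh]
    field_simp
    linear_combination (-1 : ℝ) * cosh_sq (a * (1 - z))
  have hint : IntervalIntegrable (fun z => (cosh (a * (1 - z)) ^ 2)⁻¹) volume 0 1 := by
    refine Continuous.intervalIntegrable (Continuous.inv₀ ?_ fun z => ?_) 0 1
    · exact (continuous_cosh.comp (by fun_prop)).pow 2
    · exact pow_ne_zero 2 (cosh_pos _).ne'
  simp only [hexp, hsq]
  rw [intervalIntegral.integral_sub intervalIntegrable_const (hint.const_mul _),
    intervalIntegral.integral_const_mul, intervalIntegral.integral_const_mul,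
    integral_inv_cosh_sq ha, intervalIntegral.integral_const, tanh_eq_sinh_div_cosh, hs]
  simp only [smul_eq_mul]
  field_simp
  ring

/-- Closed form of the zero-correlation short-maturity rate function:
`inf_{u,v>0} { (1/2) I(u,v) + (2/u) ζ² } = 2 log²(√(ζ²+1) + |ζ|)`. -/
theorem ratefun_short_maturity (ζ : ℝ) :
    sInf {r : ℝ | ∃ u v : ℝ, 0 < u ∧ 0 < v ∧
        r = (1 / 2) * ratefun u v + (2 / u) * ζ ^ 2} =
      2 * (Real.log (Real.sqrt (ζ ^ 2 + 1) + |ζ|)) ^ 2 := by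
  have hlog : log (√(ζ ^ 2 + 1) + |ζ|) = arsinh |ζ| := by
    rw [arsinh, sq_abs, add_comm, add_comm (ζ ^ 2)]
  rw [hlog]
  have hlower : ∀ r ∈ {r : ℝ | ∃ u v : ℝ, 0 < u ∧ 0 < v ∧
      r = (1 / 2) * ratefun u v + (2 / u) * ζ ^ 2}, 2 * arsinh |ζ| ^ 2 ≤ r := by
    rintro r ⟨u, v, hu, hv, rfl⟩
    simpa only [sq_abs] using two_mul_sq_arsinh_le hu hv |ζ|
  obtain ⟨g, hg, heq⟩ := exists_optimal_path |ζ|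
  rw [sq_abs] at heq
  have hg1 := hg.intervalIntegrable (μ := volume) 0 1
  refine le_antisymm ((csInf_le ⟨_, hlower⟩
    ⟨_, exp (∫ t in (0:ℝ)..1, g t), integral_exp_primitive_pos hg1, exp_pos _, rfl⟩).trans ?_)
    (le_csInf ⟨_, 1, 1, one_pos, one_pos, rfl⟩ hlower)
  have hle := ratefun_le hg1 ((hg.pow 2).intervalIntegrable 0 1)
  rw [div_mul_eq_mul_div 2, mul_div_assoc]
  linarith
end
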